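/- For all k ≥ 2, the weak complexity of the class of all countable graphs omitting all cycles of length at most 2k equals 2^{ℵ_0}; in particular, for every set I of fewer than 2^{ℵ_0} countable graphs, each omitting all cycles of length at most 2k, there exists a countable graph omitting all cycles of length at most 2k that is not isomorphic to a subgraph of any member of I. -/

import Mathlib

open SimpleGraph

/-- `G` is isomorphic to a (not necessarily induced) subgraph of `G`:
    there is an injective graph homomorphism from `H` to `G`. -/
def IsSubgraphOf {V W : Type*} (H : SimpleGraph V) (G : SimpleGraph W) : Prop :=
  ∃ f : H →g G, Function.Injective f

/-- `G` omits all cycles of length at most `2k`: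
    every cycle in `G` has length greater than `2k`. -/
def NoShortCycles (k : ℕ) {V : Type*} (G : SimpleGraph V) : Prop :=
  ∀ (v : V) (c : G.Walk v v), c.IsCycle → 2 * k < c.length

/-- Reduced words of length at most `L` over involutive letters. -/
abbrev ReducedWord (α : Type) (L : ℕ) : Type :=
  {l : List α // l.IsChain (· ≠ ·) ∧ l.length ≤ L}

namespace ReducedWord

variable {α : Type} [DecidableEq α] {L : ℕ}

/-- Left multiplication by the letter `i`, truncated at length `L`. -/
def toggleList (L : ℕ) (i : α) (l : List α) : List α :=
  if l.head? = some i then l.tail else if l.length < L then i :: l else l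

lemma toggleList_mem (i : α) (l : ReducedWord α L) :
    (toggleList L i l.1).IsChain (· ≠ ·) ∧ (toggleList L i l.1).length ≤ L := by
  obtain ⟨l, hl, hlen⟩ := l
  unfold toggleList
  split_ifs with h₁ h₂
  · exact ⟨hl.tail, by simp; omega⟩
  · refine ⟨?_, by simpa using h₂⟩
    rw [List.isChain_cons]
    refine ⟨fun y hy hiy => h₁ ?_, hl⟩
    subst hiy
    exact hy
  · exact ⟨hl, hlen⟩

lemma toggleList_toggleList (i : α) (l : ReducedWord α L) :
    toggleList L i (toggleList L i l.1) = l.1 := by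
  obtain ⟨l, hl, hlen⟩ := l
  cases l with
  | nil => by_cases hL : 0 < L <;> simp [toggleList, hL]
  | cons j t =>
    rw [List.isChain_cons] at hl
    by_cases hj : j = i
    · subst hj
      have ht : t.head? ≠ some j := fun h => hl.1 j h rfl
      have hlt : t.length < L := by simpa using hlen
      simp [toggleList, ht, hlt]
    · by_cases hlt : t.length + 1 < L <;> simp [toggleList, hj, hlt]

/-- The permutation of truncated reduced words induced by a letter. -/
def toggle (L : ℕ) (i : α) : Equiv.Perm (ReducedWord α L) :=
  Function.Involutive.toPerm (fun l => ⟨toggleList L i l.1, toggleList_mem i l⟩)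
    fun l => Subtype.ext (toggleList_toggleList i l)

@[simp] lemma toggle_mul_self (i : α) : toggle L i * toggle L i = 1 :=
  Equiv.ext fun l => Subtype.ext (toggleList_toggleList i l)

@[simp] lemma toggle_mul_self_mul (i : α) (x : Equiv.Perm (ReducedWord α L)) :
    toggle L i * (toggle L i * x) = x := by
  rw [← mul_assoc, toggle_mul_self, one_mul]

lemma prod_toggle_apply_nil (l : List α) (hl : l.IsChain (· ≠ ·)) (hlen : l.length ≤ L) :
    ((l.map (toggle L)).prod ⟨[], by simp⟩).1 = l := by
  induction l with
  | nil => simp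
  | cons i t ih =>
    rw [List.isChain_cons] at hl
    have hlt : t.length < L := by simpa using hlen
    have ht : t.head? ≠ some i := fun h => hl.1 i h rfl
    have := ih hl.2 hlt.le
    simp only [List.map_cons, List.prod_cons, Equiv.Perm.mul_apply]
    change toggleList L i (((t.map (toggle L)).prod ⟨[], by simp⟩).1) = _
    rw [this]
    simp [toggleList, ht, hlt]

lemma eq_nil_of_prod_toggle_eq_one {l : List α} (hl : l.IsChain (· ≠ ·)) (hlen : l.length ≤ L)
    (h : (l.map (toggle L)).prod = 1) : l = [] := by
  rw [← prod_toggle_apply_nil l hl hlen, h]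
  rfl

instance [Finite α] : Finite (ReducedWord α L) :=
  (List.finite_length_le α L).subset
    (fun _ h => h.2 : {l : List α | l.IsChain (· ≠ ·) ∧ l.length ≤ L} ⊆ _)

end ReducedWord

section LabelledGraph

open ReducedWord

variable {V α : Type} [DecidableEq α] {L : ℕ} {G : SimpleGraph V}
  {R : V → List α → V → Prop} {φ : V → Equiv.Perm (ReducedWord α L)}

lemma exists_label_of_isTrail {B : ℕ}
    (hadj : ∀ u v, G.Adj u v → ∃ l, R u l v)
    (hφ : ∀ u l v, R u l v → φ v = φ u * (l.map (toggle L)).prod)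
    (hR : ∀ u l v, R u l v → l ≠ [] ∧ l.IsChain (· ≠ ·) ∧ l.length ≤ B)
    (hturn : ∀ u l v m w, R u l v → R v m w → u ≠ w →
      ∀ x ∈ l.getLast?, ∀ y ∈ m.head?, x ≠ y)
    {u v : V} (p : G.Walk u v) (hp : p.IsTrail) :
    ∃ l : List α, l.IsChain (· ≠ ·) ∧ l.length ≤ B * p.length ∧
      φ v = φ u * (l.map (toggle L)).prod ∧ (l = [] → p.length = 0) ∧
      (l ≠ [] → ∃ m w, R u m w ∧ s(u, w) ∈ p.edges ∧ l.head? = m.head?) := by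
  induction p with
  | nil => exact ⟨[], by simp⟩
  | @cons u v w h q ih =>
    rw [Walk.isTrail_cons] at hp
    obtain ⟨l', hc, hlen, hprod, -, hhead⟩ := ih hp.1
    obtain ⟨l, hl⟩ := hadj _ _ h
    obtain ⟨hne, hlc, hlB⟩ := hR _ _ _ hl
    refine ⟨l ++ l', ?_, ?_, ?_, by simp [hne], fun _ => ⟨l, v, hl, by simp, ?_⟩⟩
    · rw [List.isChain_append]
      refine ⟨hlc, hc, fun x hx y hy => ?_⟩
      obtain ⟨m, z, hm, hz, hmz⟩ := hhead (by rintro rfl; simp at hy)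
      refine hturn _ _ _ _ _ hl hm ?_ x hx y (hmz ▸ hy)
      rintro rfl
      exact hp.2 (Sym2.eq_swap ▸ hz)
    · simp only [List.length_append, Walk.length_cons]
      nlinarith
    · rw [hprod, hφ _ _ _ hl]
      simp [mul_assoc]
    · cases l with
      | nil => exact absurd rfl hne
      | cons => simp

lemma noShortCycles_of_label {k B : ℕ} (hB : B * (2 * k) ≤ L)
    (hadj : ∀ u v, G.Adj u v → ∃ l, R u l v)
    (hφ : ∀ u l v, R u l v → φ v = φ u * (l.map (toggle L)).prod)
    (hR : ∀ u l v, R u l v → l ≠ [] ∧ l.IsChain (· ≠ ·) ∧ l.length ≤ B)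
    (hturn : ∀ u l v m w, R u l v → R v m w → u ≠ w →
      ∀ x ∈ l.getLast?, ∀ y ∈ m.head?, x ≠ y) : NoShortCycles k G := by
  intro v c hc
  by_contra! hlt
  obtain ⟨l, hl, hlen, hprod, hnil, -⟩ :=
    exists_label_of_isTrail hadj hφ hR hturn c hc.isTrail
  have h1 : (l.map (toggle L)).prod = 1 := by simpa using hprod.symm
  have := hnil (eq_nil_of_prod_toggle_eq_one hl
    (hlen.trans ((Nat.mul_le_mul_left B hlt).trans hB)) h1)
  have := hc.three_le_length
  omega

end LabelledGraph

namespace CodingGraph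

open ReducedWord

/-- Letters `inl (b, p)` label edges between consecutive layers, where `p` is a parity; the
letters `inr b` label the coding edges. -/
abbrev Letter : Type := Bool × Bool ⊕ Bool

/-- The finite group whose copies form the layers. -/
abbrev Layer (L : ℕ) : Type := Equiv.Perm (ReducedWord Letter L)

/-- A layered vertex set together with one auxiliary vertex for each bit. -/
abbrev Vertex (L : ℕ) : Type := (ℕ × Layer L) ⊕ ℕ

/-- The second endpoint of a coding pair, the first one being the identity. -/
def mark (L : ℕ) : Layer L := toggle L (Sum.inr false) * toggle L (Sum.inr true)

/-- Oriented labelled edges: the bit `s n` decides whether the `n`-th coding pair is joined by an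
edge or by a path of length two. -/
inductive Step (L : ℕ) (s : ℕ → Bool) : Vertex L → List Letter → Vertex L → Prop
  | down (n : ℕ) (x : Layer L) (b : Bool) :
      Step L s (.inl (n + 1, x)) [.inl (b, n.bodd)] (.inl (n, x * toggle L (.inl (b, n.bodd))))
  | edge (n : ℕ) (h : s n = false) :
      Step L s (.inl (n, 1)) [.inr false, .inr true] (.inl (n, mark L))
  | left (n : ℕ) (h : s n = true) : Step L s (.inl (n, 1)) [.inr false] (.inr n)
  | right (n : ℕ) (h : s n = true) : Step L s (.inr n) [.inr true] (.inl (n, mark L))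

variable {L : ℕ} {s : ℕ → Bool}

/-- The symmetric closure of `Step`. -/
def Edge (L : ℕ) (s : ℕ → Bool) (u : Vertex L) (l : List Letter) (v : Vertex L) : Prop :=
  Step L s u l v ∨ Step L s v l.reverse u

lemma Edge.symm {u v : Vertex L} {l : List Letter} (h : Edge L s u l v) :
    Edge L s v l.reverse u := by
  simpa [Edge, or_comm] using h

/-- The projection of a vertex to the group. -/
def proj : Vertex L → Layer L
  | .inl (_, x) => x
  | .inr _ => toggle L (.inr false)

lemma Step.proj_eq {u v : Vertex L} {l : List Letter} (h : Step L s u l v) :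
    proj v = proj u * (l.map (toggle L)).prod := by
  cases h <;> simp [proj, mark]

lemma Edge.proj_eq {u v : Vertex L} {l : List Letter} (h : Edge L s u l v) :
    proj v = proj u * (l.map (toggle L)).prod := by
  rcases h with h | h
  · exact h.proj_eq
  · have hinv : ∀ i : Letter, (toggle L i)⁻¹ = toggle L i := fun i =>
      inv_eq_of_mul_eq_one_left (toggle_mul_self i)
    have : (l.reverse.map (toggle L)).prod = (l.map (toggle L)).prod⁻¹ := by
      rw [List.prod_inv_reverse, List.map_map, List.map_reverse]
      simp only [Function.comp_def, hinv]
    rw [h.proj_eq, this, inv_mul_cancel_right]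

lemma Step.isReduced {u v : Vertex L} {l : List Letter} (h : Step L s u l v) :
    l ≠ [] ∧ l.IsChain (· ≠ ·) ∧ l.length ≤ 2 := by
  cases h <;> simp

lemma Edge.isReduced {u v : Vertex L} {l : List Letter} (h : Edge L s u l v) :
    l ≠ [] ∧ l.IsChain (· ≠ ·) ∧ l.length ≤ 2 := by
  rcases h with h | h
  · exact h.isReduced
  · obtain ⟨h₁, h₂, h₃⟩ := h.isReduced
    rw [List.isChain_reverse] at h₂
    exact ⟨by simpa using h₁, h₂.imp fun _ _ h => h.symm, by simpa using h₃⟩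

/-- The other end of the edge at a given vertex whose label starts with a given letter. -/
def target (s : ℕ → Bool) : Vertex L → Letter → Vertex L
  | .inl (n, x), .inl (b, p) =>
      if p = n.bodd then .inl (n + 1, x * toggle L (.inl (b, p)))
      else .inl (n - 1, x * toggle L (.inl (b, p)))
  | .inl (n, _), .inr b => if s n then .inr n else .inl (n, if b then 1 else mark L)
  | .inr n, .inr b => .inl (n, if b then mark L else 1)
  | .inr n, .inl _ => .inr n

lemma Step.target_head {u v : Vertex L} {l : List Letter} (h : Step L s u l v) :
    ∀ i ∈ l.head?, target s u i = v := by
  cases h <;> simp_all [target]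

lemma Step.target_getLast {u v : Vertex L} {l : List Letter} (h : Step L s u l v) :
    ∀ i ∈ l.getLast?, target s v i = u := by
  cases h <;> simp_all [target, mul_assoc]

lemma Edge.target_head {u v : Vertex L} {l : List Letter} (h : Edge L s u l v) :
    ∀ i ∈ l.head?, target s u i = v := by
  rcases h with h | h
  · exact h.target_head
  · simpa using h.target_getLast

lemma Edge.ne_of_turn {u v w : Vertex L} {l m : List Letter} (h : Edge L s u l v)
    (h' : Edge L s v m w) (huw : u ≠ w) : ∀ x ∈ l.getLast?, ∀ y ∈ m.head?, x ≠ y := by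
  rintro x hx _ hy rfl
  exact huw ((h.symm.target_head x (by simpa using hx)).symm.trans (h'.target_head x hy))

lemma mark_ne_one (hL : 2 ≤ L) : mark L ≠ 1 := by
  intro h
  have := eq_nil_of_prod_toggle_eq_one (L := L) (l := [Sum.inr false, (Sum.inr true : Letter)])
    (by simp) (by simpa using hL) (by simpa [mark] using h)
  simp at this

lemma toggle_ne_toggle (hL : 2 ≤ L) {i j : Letter} (hij : i ≠ j) : toggle L i ≠ toggle L j := by
  intro h
  have := eq_nil_of_prod_toggle_eq_one (L := L) (l := [i, j])
    (by simpa using hij) (by simpa using hL) (by simp [h])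
  simp at this

/-- The graph coding the binary sequence `s`. -/
def graph (L : ℕ) (s : ℕ → Bool) : SimpleGraph (Vertex L) where
  Adj u v := u ≠ v ∧ ∃ l, Edge L s u l v
  symm := ⟨fun _ _ ⟨hne, l, h⟩ => ⟨hne.symm, l.reverse, h.symm⟩⟩
  loopless := ⟨fun _ h => h.1 rfl⟩

lemma Step.adj {u v : Vertex L} {l : List Letter} (h : Step L s u l v) (hne : u ≠ v) :
    (graph L s).Adj u v := ⟨hne, l, .inl h⟩

lemma noShortCycles_graph {k : ℕ} (hL : 2 * (2 * k) ≤ L) (s : ℕ → Bool) :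
    NoShortCycles k (graph L s) :=
  noShortCycles_of_label (R := Edge L s) (φ := proj) hL (fun _ _ h => h.2)
    (fun _ _ _ h => h.proj_eq) (fun _ _ _ h => h.isReduced) (fun _ _ _ _ _ => Edge.ne_of_turn)

end CodingGraph

section ShortCycles

variable {V : Type*} {G : SimpleGraph V} {k : ℕ}

lemma NoShortCycles.not_triangle (hG : NoShortCycles k G) (hk : 2 ≤ k) {a b c : V}
    (hab : G.Adj a b) (hbc : G.Adj b c) (hca : G.Adj c a) : False := by
  have := hG a (.cons hab (.cons hbc (.cons hca .nil))) (by
    simp [Walk.isCycle_def, hab.ne, hab.ne', hbc.ne, hca.ne, hca.ne'])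
  simp at this
  omega

lemma NoShortCycles.eq_of_common_neighbors (hG : NoShortCycles k G) (hk : 2 ≤ k) {a b c d : V}
    (hac : a ≠ c) (hab : G.Adj a b) (hbc : G.Adj b c) (had : G.Adj a d) (hdc : G.Adj d c) :
    b = d := by
  by_contra hbd
  have := hG a (.cons hab (.cons hbc (.cons hdc.symm (.cons had.symm .nil)))) (by
    simp [Walk.isCycle_def, hab.ne, hab.ne', hbc.ne, hdc.ne', had.ne, had.ne',
      hac, hac.symm, hbd])
  simp at this
  omega

lemma NoShortCycles.of_injective {W : Type*} {H : SimpleGraph W} (hG : NoShortCycles k G)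
    (f : H →g G) (hf : Function.Injective f) : NoShortCycles k H := by
  intro v c hc
  simpa using hG _ _ (hc.map hf)

end ShortCycles

namespace CodingGraph

open ReducedWord

variable {L k : ℕ} {s t : ℕ → Bool} {V : Type*} {G : SimpleGraph V}

lemma agree_on_layers (hL : 2 ≤ L) (hk : 2 ≤ k) (hG : NoShortCycles k G)
    {f : graph L s →g G} {g : graph L t →g G} (hf : Function.Injective f)
    (hroot : ∀ x, f (.inl (0, x)) = g (.inl (0, x))) (n : ℕ) (x : Layer L) :
    f (.inl (n, x)) = g (.inl (n, x)) := by
  induction n generalizing x with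
  | zero => exact hroot x
  | succ n ih =>
    have hf' (b : Bool) := f.map_adj ((Step.down (s := s) n x b).adj (by simp))
    have hg' (b : Bool) := g.map_adj ((Step.down (s := t) n x b).adj (by simp))
    simp only [← ih] at hg'
    refine hG.eq_of_common_neighbors hk ?_ (hf' false).symm (hf' true) (hg' false).symm (hg' true)
    intro h
    have := hf h
    simp only [Sum.inl.injEq, Prod.mk.injEq, mul_right_inj, true_and] at this
    exact toggle_ne_toggle hL (by simp) this

lemma not_true_of_false (hL : 2 ≤ L) (hk : 2 ≤ k) (hG : NoShortCycles k G)
    {f : graph L s →g G} {g : graph L t →g G} (hf : Function.Injective f)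
    (hroot : ∀ x, f (.inl (0, x)) = g (.inl (0, x))) {n : ℕ} (hs : s n = false) :
    t n = false := by
  by_contra ht
  rw [Bool.not_eq_false] at ht
  have h₁ := f.map_adj ((Step.edge n hs).adj (by simp [(mark_ne_one hL).symm]))
  have h₂ := g.map_adj ((Step.left n ht).adj (by simp))
  have h₃ := g.map_adj ((Step.right n ht).adj (by simp))
  rw [← agree_on_layers hL hk hG hf hroot] at h₂ h₃
  exact hG.not_triangle hk h₂ h₃ h₁.symm

lemma eq_of_agree_on_root (hL : 2 ≤ L) (hk : 2 ≤ k) (hG : NoShortCycles k G)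
    {f : graph L s →g G} {g : graph L t →g G} (hf : Function.Injective f)
    (hg : Function.Injective g) (hroot : ∀ x, f (.inl (0, x)) = g (.inl (0, x))) : s = t := by
  funext n
  have h₁ := not_true_of_false hL hk hG hf hroot (n := n)
  have h₂ := not_true_of_false hL hk hG hg (fun x => (hroot x).symm) (n := n)
  cases hs : s n <;> cases ht : t n <;> simp_all

theorem exists_not_isSubgraphOf (hk : 2 ≤ k) (ι : Type) (Vf : ι → Type)
    (Gf : ∀ i, SimpleGraph (Vf i)) (hι : Cardinal.mk ι < Cardinal.continuum)
    (hGf : ∀ i, Countable (Vf i) ∧ NoShortCycles k (Gf i)) :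
    ∃ (W : Type) (H : SimpleGraph W), Countable W ∧ NoShortCycles k H ∧
      ∀ i, ¬ IsSubgraphOf H (Gf i) := by
  by_contra! hcon
  have hsub (s : ℕ → Bool) :
      ∃ i, ∃ f : graph (2 * (2 * k)) s →g Gf i, Function.Injective f :=
    hcon _ _ inferInstance (noShortCycles_graph le_rfl s)
  choose i f hf using hsub
  have : ∀ i, Countable (Vf i) := fun i => (hGf i).1
  have hcode (i : ι) : ∃ e : (Layer (2 * (2 * k)) → Vf i) → ℕ, Function.Injective e :=
    exists_injective_nat _
  choose e he using hcode
  have hinj : Function.Injective fun s : ℕ → Bool =>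
      (i s, e (i s) fun x => f s (.inl (0, x))) := by
    intro s t hst
    simp only [Prod.mk.injEq] at hst
    obtain ⟨hi, hst⟩ := hst
    have key : ∀ (j j' : ι) (g : graph (2 * (2 * k)) s →g Gf j)
        (g' : graph (2 * (2 * k)) t →g Gf j'), Function.Injective g → Function.Injective g' →
        j = j' → (e j fun x => g (.inl (0, x))) = (e j' fun x => g' (.inl (0, x))) → s = t := by
      rintro j _ g g' hg hg' rfl h
      exact eq_of_agree_on_root (by omega) hk (hGf j).2 hg hg' (congrFun (he j h))
    exact key _ _ _ _ (hf s) (hf t) hi hst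
  have hle := Cardinal.mk_le_of_injective hinj
  have hlt : Cardinal.mk (ι × ℕ) < Cardinal.continuum := by
    rw [Cardinal.mk_prod, Cardinal.lift_id, Cardinal.lift_id]
    exact Cardinal.mul_lt_of_lt Cardinal.aleph0_le_continuum hι
      (by simpa using Cardinal.aleph0_lt_continuum)
  refine absurd (hle.trans_lt hlt) (by simp)

end CodingGraph

theorem exists_continuum_family (k : ℕ) :
    ∃ (ι : Type) (Vf : ι → Type) (Gf : ∀ i, SimpleGraph (Vf i)),
      Cardinal.mk ι = Cardinal.continuum ∧
      (∀ i, Countable (Vf i) ∧ NoShortCycles k (Gf i)) ∧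
      ∀ (W : Type) (H : SimpleGraph W), Countable W → NoShortCycles k H →
        ∃ i, IsSubgraphOf H (Gf i) := by
  classical
  let Γ (i : Set ℕ × Set (ℕ × ℕ)) : SimpleGraph i.1 := .fromRel fun x y => (x.1, y.1) ∈ i.2
  refine ⟨Set ℕ × Set (ℕ × ℕ), fun i => i.1,
    fun i => if NoShortCycles k (Γ i) then Γ i else ⊥, by simp, fun i => ⟨inferInstance, ?_⟩,
    fun W H hW hH => ?_⟩
  · dsimp only
    split_ifs with h
    · exact h
    · rintro v (_ | ⟨h, _⟩) hc
      · exact absurd hc (by simp)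
      · exact absurd h (by simp)
  · obtain ⟨e, he⟩ := exists_injective_nat W
    let ε : W ≃ Set.range e := Equiv.ofInjective e he
    let i : Set ℕ × Set (ℕ × ℕ) := (Set.range e, {p | ∃ u v, H.Adj u v ∧ p = (e u, e v)})
    have hadj (u v : W) : (Γ i).Adj (ε u) (ε v) ↔ H.Adj u v := by
      have hε (w : W) : (ε w : ℕ) = e w := rfl
      simp only [Γ, i, SimpleGraph.fromRel_adj, ne_eq, ε.injective.eq_iff, Set.mem_ofPred_eq, hε,
        Prod.mk.injEq, he.eq_iff]
      constructor
      · rintro ⟨-, ⟨_, _, h, rfl, rfl⟩ | ⟨_, _, h, rfl, rfl⟩⟩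
        exacts [h, h.symm]
      · exact fun h => ⟨h.ne, .inl ⟨u, v, h, rfl, rfl⟩⟩
    have hi : NoShortCycles k (Γ i) := by
      refine hH.of_injective ⟨ε.symm, fun {a b} h => ?_⟩ ε.symm.injective
      rw [← hadj]
      simpa using h
    refine ⟨i, ?_⟩
    simp only [hi, if_true]
    exact ⟨⟨ε, fun {a b} h => (hadj a b).2 h⟩, ε.injective⟩

/-- The weak complexity of the class of countable graphs omitting all cycles of length
    at most `2k` (for `k ≥ 2`) equals `2^ℵ₀`: no family of fewer than `2^ℵ₀` such graphs
    contains every such graph as a subgraph of one of its members, while some family of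
    cardinality `2^ℵ₀` does. -/
theorem weak_complexity_without_short_cycles (k : ℕ) (hk : 2 ≤ k) :
    (∀ (ι : Type) (Vf : ι → Type) (Gf : ∀ i, SimpleGraph (Vf i)),
        Cardinal.mk ι < Cardinal.continuum →
        (∀ i, Countable (Vf i) ∧ NoShortCycles k (Gf i)) →
        ∃ (W : Type) (H : SimpleGraph W), Countable W ∧ NoShortCycles k H ∧
          ∀ i, ¬ IsSubgraphOf H (Gf i)) ∧
    (∃ (ι : Type) (Vf : ι → Type) (Gf : ∀ i, SimpleGraph (Vf i)),
        Cardinal.mk ι = Cardinal.continuum ∧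
        (∀ i, Countable (Vf i) ∧ NoShortCycles k (Gf i)) ∧
        ∀ (W : Type) (H : SimpleGraph W), Countable W → NoShortCycles k H →
          ∃ i, IsSubgraphOf H (Gf i)) := by
  exact ⟨CodingGraph.exists_not_isSubgraphOf hk, exists_continuum_family k⟩
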